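/- Let a<b be real, let p ∈ ]1,+∞[, and let ψ : ℝ → ]0,+∞[ be a bounded Borel function with ∫_{−∞}^{+∞} ψ(t)^{1/p} dt < +∞ and inf_K ψ > 0 for every compact K ⊂ ℝ. Then for every C > 0 there exists λ̄ = λ̄(C) with the following property: for every g ∈ C¹([a,b]) ∩ X^p_ψ(]a,b[) with ‖g‖_{C¹([a,b])} ≤ C and F̄_p(g) ≤ C, and for every λ ≥ λ̄, every solution u of min{ F̄_p(w) + λ∫_a^b |w − g|² dx : w ∈ X^p_ψ(]a,b[) } belongs to C¹([a,b]). -/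

import Mathlib

open MeasureTheory Filter Set Topology
open scoped ENNReal NNReal

noncomputable section

/-- `Ψ₁(t) = ∫_{-∞}^t ψ(s) ds`. -/
def Psi1 (ψ : ℝ → ℝ) (t : ℝ) : ℝ := ∫ s in Set.Iic t, ψ s

/-- `Ψ_p(t) = ∫_{-∞}^t ψ(s)^{1/p} ds`. -/
def Psip (ψ : ℝ → ℝ) (p t : ℝ) : ℝ := ∫ s in Set.Iic t, ψ s ^ (1 / p)

/-- The natural extension of `Ψ₁` to the extended reals:
`Ψ₁(-∞) = 0`, `Ψ₁(+∞) = ∫_ℝ ψ`. -/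
def Psi1E (ψ : ℝ → ℝ) (t : EReal) : ℝ :=
  if t = ⊤ then ∫ s, ψ s else if t = ⊥ then 0 else Psi1 ψ t.toReal

/-- Standing assumptions on `ψ` in the case `p = 1`: a bounded, everywhere positive
Borel function, integrable on `ℝ`, whose infimum on every compact set is positive. -/
structure PsiHyp (ψ : ℝ → ℝ) : Prop where
  measurable : Measurable ψ
  pos : ∀ t, 0 < ψ t
  bounded : ∃ C, ∀ t, ψ t ≤ C
  integrable : MeasureTheory.Integrable ψ
  inf_pos : ∀ K : Set ℝ, IsCompact K → ∃ δ > 0, ∀ t ∈ K, δ ≤ ψ t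

/-- Standing assumptions on `ψ` in the case `p > 1`: as in `PsiHyp` but with
`ψ^{1/p}` integrable on `ℝ`. -/
structure PsiHypP (ψ : ℝ → ℝ) (p : ℝ) : Prop where
  measurable : Measurable ψ
  pos : ∀ t, 0 < ψ t
  bounded : ∃ C, ∀ t, ψ t ≤ C
  integrable : MeasureTheory.Integrable fun t => ψ t ^ (1 / p)
  inf_pos : ∀ K : Set ℝ, IsCompact K → ∃ δ > 0, ∀ t ∈ K, δ ≤ ψ t

/-- `(μp, μn)` is the Jordan decomposition of the distributional derivative of
`u ∈ L¹(]a,b[)`; the existence of such a pair encodes `u ∈ BV(]a,b[)`,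
and `μp + μn` is the total variation measure `|u'|`. -/
def IsDerivMeasures (a b : ℝ) (u : ℝ → ℝ) (μp μn : Measure ℝ) : Prop :=
  MeasureTheory.IntegrableOn u (Set.Ioo a b) ∧
  IsFiniteMeasure μp ∧ IsFiniteMeasure μn ∧ μp ⟂ₘ μn ∧
  μp (Set.Ioo a b)ᶜ = 0 ∧ μn (Set.Ioo a b)ᶜ = 0 ∧
  ∀ φ : ℝ → ℝ, ContDiff ℝ 1 φ → tsupport φ ⊆ Set.Ioo a b →
    ∫ x in Set.Ioo a b, u x * deriv φ x = (∫ x, φ x ∂μn) - ∫ x, φ x ∂μp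

/-- The density `(u')^a` of the absolutely continuous part of the derivative whose
Jordan decomposition is `(μp, μn)`. -/
def uaD (μp μn : Measure ℝ) (x : ℝ) : ℝ :=
  (μp.rnDeriv MeasureTheory.volume x).toReal - (μn.rnDeriv MeasureTheory.volume x).toReal

/-- Left approximate limit `u₋(y) = lim_{ε→0⁺} ε⁻¹ ∫_{y-ε}^y u`. -/
def leftApproxLim (u : ℝ → ℝ) (y : ℝ) : ℝ :=
  limUnder (𝓝[>] (0 : ℝ)) fun ε => (∫ x in Set.Ioo (y - ε) y, u x) / ε

/-- Right approximate limit `u₊(y) = lim_{ε→0⁺} ε⁻¹ ∫_y^{y+ε} u`. -/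
def rightApproxLim (u : ℝ → ℝ) (y : ℝ) : ℝ :=
  limUnder (𝓝[>] (0 : ℝ)) fun ε => (∫ x in Set.Ioo y (y + ε), u x) / ε

/-- Left approximate limit computed in the extended reals (may be `±∞`). -/
def leftApproxLimE (u : ℝ → ℝ) (y : ℝ) : EReal :=
  limUnder (𝓝[>] (0 : ℝ)) fun ε => (((∫ x in Set.Ioo (y - ε) y, u x) / ε : ℝ) : EReal)

/-- Right approximate limit computed in the extended reals (may be `±∞`). -/
def rightApproxLimE (u : ℝ → ℝ) (y : ℝ) : EReal :=
  limUnder (𝓝[>] (0 : ℝ)) fun ε => (((∫ x in Set.Ioo y (y + ε), u x) / ε : ℝ) : EReal)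

/-- The jump set `S_u` of `u` in `]a,b[`. -/
def jumpSet (a b : ℝ) (u : ℝ → ℝ) : Set ℝ :=
  {y | y ∈ Set.Ioo a b ∧ leftApproxLim u y ≠ rightApproxLim u y}

/-- `ν_u = sign(u₊ - u₋)`. -/
def jumpSign (u : ℝ → ℝ) (y : ℝ) : ℝ :=
  Real.sign (rightApproxLim u y - leftApproxLim u y)

/-- `Z⁺[w] = {x ∈ ]a,b[ : lim_{ε→0⁺} (2ε)⁻¹∫_{x-ε}^{x+ε} w = +∞}`. -/
def ZPlus (a b : ℝ) (w : ℝ → ℝ) : Set ℝ :=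
  {x | x ∈ Set.Ioo a b ∧
    Tendsto (fun ε => (∫ t in Set.Ioo (x - ε) (x + ε), w t) / (2 * ε)) (𝓝[>] (0 : ℝ)) atTop}

/-- `Z⁻[w] = {x ∈ ]a,b[ : lim_{ε→0⁺} (2ε)⁻¹∫_{x-ε}^{x+ε} w = -∞}`. -/
def ZMinus (a b : ℝ) (w : ℝ → ℝ) : Set ℝ :=
  {x | x ∈ Set.Ioo a b ∧
    Tendsto (fun ε => (∫ t in Set.Ioo (x - ε) (x + ε), w t) / (2 * ε)) (𝓝[>] (0 : ℝ)) atBot}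

/-- The positive part `((u')^c)⁺` of the Cantor part of the derivative of `u`:
the singular part of `μp` with the atoms on the jump set removed. -/
def cantorPos (a b : ℝ) (u : ℝ → ℝ) (μp : Measure ℝ) : Measure ℝ :=
  (μp.singularPart MeasureTheory.volume).restrict (jumpSet a b u)ᶜ

/-- The negative part `((u')^c)⁻` of the Cantor part of the derivative of `u`. -/
def cantorNeg (a b : ℝ) (u : ℝ → ℝ) (μn : Measure ℝ) : Measure ℝ :=
  (μn.singularPart MeasureTheory.volume).restrict (jumpSet a b u)ᶜ

/-- `u ∈ X¹_ψ(]a,b[)`, with derivative data `(μp, μn)`:  `u ∈ BV(]a,b[)`,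
`Ψ₁∘(u')^a ∈ BV(]a,b[)`, and `((u')^c)^±` is concentrated on `Z^±[(u')^a]`. -/
def MemX1 (ψ : ℝ → ℝ) (a b : ℝ) (u : ℝ → ℝ) (μp μn : Measure ℝ) : Prop :=
  IsDerivMeasures a b u μp μn ∧
  (∃ νp νn : Measure ℝ, IsDerivMeasures a b (fun x => Psi1 ψ (uaD μp μn x)) νp νn) ∧
  cantorPos a b u μp (ZPlus a b (uaD μp μn))ᶜ = 0 ∧
  cantorNeg a b u μn (ZMinus a b (uaD μp μn))ᶜ = 0

/-- `f ∈ W^{1,p}(]a,b[)`: `f` has an absolutely continuous representative whose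
pointwise a.e. derivative lies in `L^p(]a,b[)`. -/
def MemW1pOn (p a b : ℝ) (f : ℝ → ℝ) : Prop :=
  ∃ g w : ℝ → ℝ,
    (∀ᵐ x ∂(MeasureTheory.volume.restrict (Set.Ioo a b)), g x = f x) ∧
    MeasureTheory.IntegrableOn w (Set.Ioo a b) ∧
    MeasureTheory.IntegrableOn (fun x => |w x| ^ p) (Set.Ioo a b) ∧
    ∀ x ∈ Set.Ioo a b, ∀ y ∈ Set.Ioo a b, g y - g x = ∫ t in x..y, w t

/-- `u ∈ X^p_ψ(]a,b[)`, with derivative data `(μp, μn)`:  `u ∈ BV(]a,b[)`,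
`Ψ_p∘(u')^a ∈ W^{1,p}(]a,b[)`, and `((u')^s)^±` is concentrated on `Z^±[(u')^a]`. -/
def MemXp (ψ : ℝ → ℝ) (p a b : ℝ) (u : ℝ → ℝ) (μp μn : Measure ℝ) : Prop :=
  IsDerivMeasures a b u μp μn ∧
  MemW1pOn p a b (fun x => Psip ψ p (uaD μp μn x)) ∧
  (μp.singularPart MeasureTheory.volume) (ZPlus a b (uaD μp μn))ᶜ = 0 ∧
  (μn.singularPart MeasureTheory.volume) (ZMinus a b (uaD μp μn))ᶜ = 0

/-- `u ∈ W^{2,p}(]a,b[)` with first derivative `v` and second derivative `w`. -/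
def W2pRep (p a b : ℝ) (u v w : ℝ → ℝ) : Prop :=
  (∀ x ∈ Set.Ioo a b, HasDerivAt u (v x) x) ∧
  (∀ x ∈ Set.Ioo a b, ∀ y ∈ Set.Ioo a b, v y - v x = ∫ t in x..y, w t) ∧
  MeasureTheory.IntegrableOn u (Set.Ioo a b) ∧
  MeasureTheory.IntegrableOn v (Set.Ioo a b) ∧
  MeasureTheory.IntegrableOn w (Set.Ioo a b) ∧
  MeasureTheory.IntegrableOn (fun x => |w x| ^ p) (Set.Ioo a b)

/-- The functional `F_p(u) = ∫_a^b |u'| + ∫_a^b ψ(u')|u''|^p` if `u ∈ W^{2,p}(]a,b[)`,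
`+∞` otherwise (as an infimum over Sobolev representations). -/
def Fp (ψ : ℝ → ℝ) (p a b : ℝ) (u : ℝ → ℝ) : ℝ≥0∞ :=
  ⨅ (v : ℝ → ℝ) (w : ℝ → ℝ) (_ : W2pRep p a b u v w),
    ENNReal.ofReal ((∫ x in Set.Ioo a b, |v x|) + ∫ x in Set.Ioo a b, ψ (v x) * |w x| ^ p)

/-- Strong `L¹(]a,b[)` convergence of a sequence. -/
def TendstoL1 (a b : ℝ) (U : ℕ → ℝ → ℝ) (u : ℝ → ℝ) : Prop :=
  (∀ k, MeasureTheory.IntegrableOn (U k) (Set.Ioo a b)) ∧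
  MeasureTheory.IntegrableOn u (Set.Ioo a b) ∧
  Tendsto (fun k => ∫ x in Set.Ioo a b, |U k x - u x|) atTop (𝓝 0)

/-- The relaxed functional
`F̄_p(u) = inf { liminf_k F_p(u_k) : u_k → u in L¹(]a,b[) }`. -/
def FpRel (ψ : ℝ → ℝ) (p a b : ℝ) (u : ℝ → ℝ) : ℝ≥0∞ :=
  ⨅ (U : ℕ → ℝ → ℝ) (_ : TendstoL1 a b U u),
    liminf (fun k => Fp ψ p a b (U k)) atTop

/-- `Φ(s, t₁, t₂)` of the relaxation formula (`s` being the sign of the jump). -/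
def Phi (ψ : ℝ → ℝ) (s : ℝ) (t₁ t₂ : EReal) : ℝ :=
  if 0 < s then ((∫ t, ψ t) - Psi1E ψ t₁) + ((∫ t, ψ t) - Psi1E ψ t₂)
  else Psi1E ψ t₁ + Psi1E ψ t₂

/-- `Φ̂(s, t₁, t₂)` of Remark 2.5. -/
def PhiHat (ψ : ℝ → ℝ) (s : ℝ) (t₁ t₂ : EReal) : ℝ :=
  if 0 < s then (∫ t, ψ t) - Psi1E ψ (max t₁ t₂)
  else Psi1E ψ (min t₁ t₂)

/-- `ubar` is a `C¹([a,b])` representative of `u`. -/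
def C1Rep (a b : ℝ) (u ubar : ℝ → ℝ) : Prop :=
  (∀ᵐ x ∂(MeasureTheory.volume.restrict (Set.Ioo a b)), ubar x = u x) ∧
  ContDiffOn ℝ 1 ubar (Set.Icc a b)

/-- `u` solves `min { F̄₁(w) + λ ∫_a^b (w - G)² : w ∈ X¹_ψ(]a,b[) }`. -/
def IsSolution1 (ψ : ℝ → ℝ) (a b lam : ℝ) (G u : ℝ → ℝ) : Prop :=
  (∃ μp μn : Measure ℝ, MemX1 ψ a b u μp μn) ∧
  ∀ w : ℝ → ℝ, (∃ ηp ηn : Measure ℝ, MemX1 ψ a b w ηp ηn) →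
    FpRel ψ 1 a b u + ENNReal.ofReal (lam * ∫ x in Set.Ioo a b, (u x - G x) ^ 2) ≤
    FpRel ψ 1 a b w + ENNReal.ofReal (lam * ∫ x in Set.Ioo a b, (w x - G x) ^ 2)

/-- `u` solves `min { F̄_p(w) + λ ∫_a^b |w - G|² : w ∈ X^p_ψ(]a,b[) }`. -/
def IsSolutionP (ψ : ℝ → ℝ) (p a b lam : ℝ) (G u : ℝ → ℝ) : Prop :=
  (∃ μp μn : Measure ℝ, MemXp ψ p a b u μp μn) ∧
  ∀ w : ℝ → ℝ, (∃ ηp ηn : Measure ℝ, MemXp ψ p a b w ηp ηn) →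
    FpRel ψ p a b u + ENNReal.ofReal (lam * ∫ x in Set.Ioo a b, (u x - G x) ^ 2) ≤
    FpRel ψ p a b w + ENNReal.ofReal (lam * ∫ x in Set.Ioo a b, (w x - G x) ^ 2)

/-- The Rudin–Osher–Fatemi energy `|w'|(]a,b[) + λ∫_a^b (w-g)²`, where `(ηp, ηn)`
is the Jordan decomposition of the derivative of `w`. -/
def ROFenergy (a b lam : ℝ) (g w : ℝ → ℝ) (ηp ηn : Measure ℝ) : ℝ≥0∞ :=
  (ηp + ηn) (Set.Ioo a b) + ENNReal.ofReal (lam * ∫ x in Set.Ioo a b, (w x - g x) ^ 2)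

/-- The left-continuous generalized inverse `g^{-1}(c) = inf {x ∈ [a,b] : g(x) ≥ c}`. -/
def gInv (a b : ℝ) (g : ℝ → ℝ) (c : ℝ) : ℝ :=
  sInf {x | x ∈ Set.Icc a b ∧ c ≤ g x}

end

noncomputable section
open MeasureTheory Filter Set Topology
open scoped ENNReal NNReal

/-- The image of a set under a primitive of `W` has measure at most the integral of `|W|`. -/
theorem volume_image_le_withDensity {V W : ℝ → ℝ} (hW : Integrable W)
    (hV : ∀ x y, V y - V x = ∫ t in x..y, W t) (E : Set ℝ) :
    volume (V '' E) ≤ (volume.withDensity fun t => ‖W t‖ₑ) E := by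
  have hii : ∀ a b : ℝ, IntervalIntegrable (fun t => ‖W t‖) volume a b := fun a b =>
    hW.norm.intervalIntegrable
  have hsub : ∀ a b : ℝ, (∫ t in (0 : ℝ)..b, ‖W t‖) - (∫ t in (0 : ℝ)..a, ‖W t‖)
      = ∫ t in a..b, ‖W t‖ := fun a b =>
    intervalIntegral.integral_interval_sub_left (hii _ _) (hii _ _)
  have hnn : ∀ {a b : ℝ}, a ≤ b → 0 ≤ ∫ t in a..b, ‖W t‖ := fun h =>
    intervalIntegral.integral_nonneg h fun _ _ => norm_nonneg _
  let h : StieltjesFunction ℝ :=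
    { toFun := fun x => ∫ t in (0 : ℝ)..x, ‖W t‖
      mono' := fun a b hab => by linarith [hsub a b, hnn hab]
      right_continuous' := fun x =>
        (intervalIntegral.continuous_primitive hii 0).continuousWithinAt }
  have hmeas : h.measure = volume.withDensity fun t => ‖W t‖ₑ := by
    refine Measure.ext_of_Ioc _ _ fun a b hab => ?_
    rw [StieltjesFunction.measure_Ioc, withDensity_apply _ measurableSet_Ioc]
    change ENNReal.ofReal ((∫ t in (0 : ℝ)..b, ‖W t‖) - (∫ t in (0 : ℝ)..a, ‖W t‖)) = _
    rw [hsub, intervalIntegral.integral_of_le hab.le,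
      ofReal_integral_eq_lintegral_ofReal hW.norm.integrableOn
        (Eventually.of_forall fun _ => norm_nonneg _)]
    simp only [ofReal_norm]
  have key : OuterMeasure.comap V (volume : Measure ℝ).toOuterMeasure ≤ h.outer := by
    refine OuterMeasure.le_ofFunction.2 fun s => ?_
    rw [StieltjesFunction.length, if_neg (by simp)]
    refine le_iInf fun a => le_iInf fun b => le_iInf fun hs => ?_
    rw [OuterMeasure.comap_apply]
    have hbot : (botSet : Set ℝ) = ∅ := by
      ext t
      simp [botSet, not_isBot]
    have hs' : s ⊆ Ioc a b := by simpa [hbot] using hs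
    refine (Real.volume_le_diam _).trans (Metric.ediam_le ?_)
    rintro _ ⟨x, hx, rfl⟩ _ ⟨y, hy, rfl⟩
    wlog hxy : x ≤ y generalizing x y
    · rw [edist_comm]; exact this y hy x hx (le_of_not_ge hxy)
    have hx' := hs' hx
    have hy' := hs' hy
    rw [edist_dist, dist_comm, Real.dist_eq, hV]
    refine ENNReal.ofReal_le_ofReal ?_
    have h1 : |∫ t in x..y, W t| ≤ ∫ t in x..y, ‖W t‖ :=
      intervalIntegral.norm_integral_le_integral_norm (f := W) hxy
    have h2 := h.mono hy'.2
    have h3 := h.mono hx'.1.le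
    have h4 : h y - h x = ∫ t in x..y, ‖W t‖ := hsub x y
    linarith
  rw [← hmeas, StieltjesFunction.measure_def]
  exact key E

theorem lintegral_uIcc_le_lintegral_comp_mul {V W : ℝ → ℝ} (hW : Integrable W)
    (hV : ∀ x y, V y - V x = ∫ t in x..y, W t) {f : ℝ → ℝ≥0∞} (hf : Measurable f) (x y : ℝ) :
    ∫⁻ s in uIcc (V x) (V y), f s ≤ ∫⁻ t in uIcc x y, ‖W t‖ₑ * f (V t) := by
  have hVc : Continuous V := by
    have : V = fun t => V 0 + ∫ s in (0 : ℝ)..t, W s := by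
      ext t; linarith [hV 0 t]
    rw [this]
    exact continuous_const.add
      (intervalIntegral.continuous_primitive (fun a b => hW.intervalIntegrable) 0)
  have hle : volume.restrict (uIcc (V x) (V y)) ≤
      ((volume.withDensity fun t => ‖W t‖ₑ).restrict (uIcc x y)).map V := by
    refine Measure.le_iff.2 fun E hE => ?_
    rw [Measure.map_apply hVc.measurable hE, Measure.restrict_apply hE,
      Measure.restrict_apply (hVc.measurable hE)]
    refine le_trans (measure_mono ?_) (volume_image_le_withDensity hW hV _)
    rintro s ⟨hsE, hs⟩
    obtain ⟨t, ht, rfl⟩ := intermediate_value_uIcc hVc.continuousOn hs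
    exact ⟨t, ⟨hsE, ht⟩, rfl⟩
  refine (lintegral_mono' hle le_rfl).trans ?_
  rw [lintegral_map hf hVc.measurable, restrict_withDensity measurableSet_uIcc]
  exact (lintegral_withDensity_eq_lintegral_mul₀ hW.aestronglyMeasurable.enorm.restrict
    (hf.comp hVc.measurable).aemeasurable).le

theorem PsiHypP.psip_sub {ψ : ℝ → ℝ} {p : ℝ} (hψ : PsiHypP ψ p) (s t : ℝ) :
    Psip ψ p t - Psip ψ p s = ∫ r in s..t, ψ r ^ (1 / p) :=
  intervalIntegral.integral_Iic_sub_Iic hψ.integrable.integrableOn hψ.integrable.integrableOn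

theorem PsiHypP.psip_mono {ψ : ℝ → ℝ} {p : ℝ} (hψ : PsiHypP ψ p) : Monotone (Psip ψ p) := by
  intro s t hst
  have h1 := hψ.psip_sub s t
  have h2 : 0 ≤ ∫ r in s..t, ψ r ^ (1 / p) :=
    intervalIntegral.integral_nonneg hst fun r _ => Real.rpow_nonneg (hψ.pos r).le _
  linarith

/-- On bounded intervals `Ψ_p` has an increment bounded below linearly. -/
theorem PsiHypP.exists_mul_abs_sub_le {ψ : ℝ → ℝ} {p : ℝ} (hψ : PsiHypP ψ p) (hp : 0 < p)
    (R : ℝ) :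
    ∃ κ > 0, ∀ s ∈ Icc (-R) R, ∀ t ∈ Icc (-R) R,
      κ * |t - s| ≤ |Psip ψ p t - Psip ψ p s| := by
  obtain ⟨δ, hδ, hle⟩ := hψ.inf_pos (Icc (-R) R) isCompact_Icc
  refine ⟨δ ^ (1 / p), Real.rpow_pos_of_pos hδ _, ?_⟩
  intro s hs t ht
  wlog hst : s ≤ t generalizing s t
  · rw [abs_sub_comm t, abs_sub_comm (Psip ψ p t)]
    exact this t ht s hs (le_of_not_ge hst)
  refine le_trans ?_ (le_abs_self _)
  rw [hψ.psip_sub, abs_of_nonneg (sub_nonneg.2 hst)]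
  have h : ∫ _ in s..t, δ ^ (1 / p) ≤ ∫ r in s..t, ψ r ^ (1 / p) := by
    refine intervalIntegral.integral_mono_on hst (by simp) hψ.integrable.intervalIntegrable ?_
    intro r hr
    exact Real.rpow_le_rpow hδ.le (hle r ⟨hs.1.trans hr.1, hr.2.trans ht.2⟩) (by positivity)
  rw [intervalIntegral.integral_const, smul_eq_mul] at h
  linarith

/-- `U` is twice (weakly) differentiable on the line, with derivatives `V` and `W`, and its energy
on `]a,b[` is bounded by `K`. -/
structure EnergyBound (ψ : ℝ → ℝ) (p a b K : ℝ) (U V W : ℝ → ℝ) : Prop where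
  integrable : Integrable W
  sub_eq : ∀ x y, V y - V x = ∫ t in x..y, W t
  hasDerivAt : ∀ x, HasDerivAt U (V x) x
  lintegral_le : ∫⁻ t in Icc a b, ‖W t‖ₑ ^ p * ENNReal.ofReal (ψ (V t)) ≤ ENNReal.ofReal K
  integral_le : ∫ t in Ioo a b, |V t| ≤ K

theorem EnergyBound.continuous {ψ : ℝ → ℝ} {p a b K : ℝ} {U V W : ℝ → ℝ}
    (h : EnergyBound ψ p a b K U V W) : Continuous V := by
  have : V = fun t => V 0 + ∫ s in (0 : ℝ)..t, W s := by
    ext t; linarith [h.sub_eq 0 t]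
  rw [this]
  exact continuous_const.add
    (intervalIntegral.continuous_primitive (fun a b => h.integrable.intervalIntegrable) 0)

theorem EnergyBound.sub_eq_integral {ψ : ℝ → ℝ} {p a b K : ℝ} {U V W : ℝ → ℝ}
    (h : EnergyBound ψ p a b K U V W) (x y : ℝ) : U y - U x = ∫ t in x..y, V t :=
  (intervalIntegral.integral_eq_sub_of_hasDerivAt (fun t _ => h.hasDerivAt t)
    (h.continuous.intervalIntegrable _ _)).symm

theorem EnergyBound.ofReal_abs_psip_sub_le {ψ : ℝ → ℝ} {p a b K : ℝ} {U V W : ℝ → ℝ}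
    (h : EnergyBound ψ p a b K U V W) (hψ : PsiHypP ψ p) (hp : 1 < p) {x y : ℝ}
    (hx : x ∈ Icc a b) (hy : y ∈ Icc a b) :
    ENNReal.ofReal |Psip ψ p (V y) - Psip ψ p (V x)| ≤
      ENNReal.ofReal K ^ (1 / p) * ENNReal.ofReal |y - x| ^ (1 / p.conjExponent) := by
  have hp0 : 0 < p := by linarith
  have hq := Real.HolderConjugate.conjExponent hp
  have hφm : Measurable fun t => ENNReal.ofReal (ψ t ^ (1 / p)) :=
    (hψ.measurable.pow_const _).ennreal_ofReal
  have h1 : ENNReal.ofReal |Psip ψ p (V y) - Psip ψ p (V x)| ≤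
      ∫⁻ s in uIcc (V x) (V y), ENNReal.ofReal (ψ s ^ (1 / p)) := by
    rw [hψ.psip_sub, ← ofReal_integral_eq_lintegral_ofReal hψ.integrable.integrableOn
      (Eventually.of_forall fun r => Real.rpow_nonneg (hψ.pos r).le _)]
    refine ENNReal.ofReal_le_ofReal ?_
    rw [← Real.norm_eq_abs]
    refine intervalIntegral.norm_integral_le_integral_norm_uIoc.trans ?_
    simp_rw [Real.norm_eq_abs, abs_of_nonneg (Real.rpow_nonneg (hψ.pos _).le (1 / p))]
    exact setIntegral_mono_set hψ.integrable.integrableOn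
      (Eventually.of_forall fun r => Real.rpow_nonneg (hψ.pos r).le _)
      uIoc_subset_uIcc.eventuallyLE
  have h2 := lintegral_uIcc_le_lintegral_comp_mul h.integrable h.sub_eq hφm x y
  have hWm : AEMeasurable (fun t => ‖W t‖ₑ) (volume.restrict (uIcc x y)) :=
    h.integrable.aestronglyMeasurable.enorm.restrict
  have hFm : AEMeasurable (fun t => ‖W t‖ₑ * ENNReal.ofReal (ψ (V t) ^ (1 / p)))
      (volume.restrict (uIcc x y)) :=
    hWm.mul (hφm.comp h.continuous.measurable).aemeasurable
  have h3 := ENNReal.lintegral_mul_le_Lp_mul_Lq (volume.restrict (uIcc x y)) hq hFm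
    (aemeasurable_const (b := (1 : ℝ≥0∞)))
  simp only [Pi.mul_apply, mul_one, ENNReal.one_rpow, lintegral_const, one_mul,
    Measure.restrict_apply_univ, Real.volume_interval] at h3
  refine (h1.trans (h2.trans h3)).trans ?_
  refine mul_le_mul_left (ENNReal.rpow_le_rpow ?_ (by positivity)) _
  refine le_trans (lintegral_mono_set (uIcc_subset_Icc hx hy)) (le_trans ?_ h.lintegral_le)
  refine lintegral_mono fun t => ?_
  dsimp only
  rw [ENNReal.mul_rpow_of_nonneg _ _ hp0.le,
    ENNReal.ofReal_rpow_of_nonneg (Real.rpow_nonneg (hψ.pos _).le _) hp0.le,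
    ← Real.rpow_mul (hψ.pos _).le, one_div_mul_cancel hp0.ne', Real.rpow_one]

theorem PsiHypP.exists_modulus {ψ : ℝ → ℝ} {p : ℝ} (hψ : PsiHypP ψ p) (hp : 1 < p)
    (a b K : ℝ) {η : ℝ} (hη : 0 < η) :
    ∃ δ > 0, ∀ U V W : ℝ → ℝ, EnergyBound ψ p a b K U V W →
      ∀ x ∈ Icc a b, ∀ y ∈ Icc a b, |y - x| ≤ δ →
        |Psip ψ p (V y) - Psip ψ p (V x)| < η := by
  have hq := (Real.HolderConjugate.conjExponent hp).symm.pos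
  have hlim : Tendsto (fun d : ℝ≥0∞ => ENNReal.ofReal K ^ (1 / p) * d ^ (1 / p.conjExponent))
      (𝓝 0) (𝓝 0) := by
    have h1 : Tendsto (fun d : ℝ≥0∞ => d ^ (1 / p.conjExponent)) (𝓝 0) (𝓝 0) := by
      have := (ENNReal.continuous_rpow_const (y := 1 / p.conjExponent)).tendsto 0
      rwa [ENNReal.zero_rpow_of_pos (by positivity)] at this
    have h2 := ENNReal.Tendsto.const_mul (a := ENNReal.ofReal K ^ (1 / p)) h1
      (Or.inr (ENNReal.rpow_ne_top_of_nonneg (by positivity) ENNReal.ofReal_ne_top))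
    simpa using h2
  have hlim' : Tendsto (fun d : ℝ => ENNReal.ofReal K ^ (1 / p) *
      ENNReal.ofReal d ^ (1 / p.conjExponent)) (𝓝 0) (𝓝 0) := by
    refine hlim.comp ?_
    have := ENNReal.continuous_ofReal.tendsto 0
    rwa [ENNReal.ofReal_zero] at this
  have hev := hlim'.eventually (gt_mem_nhds (ENNReal.ofReal_pos.2 hη))
  obtain ⟨δ, hδ, hball⟩ := Metric.eventually_nhds_iff.1 hev
  refine ⟨δ / 2, by positivity, ?_⟩
  intro U V W h x hx y hy hxy
  have h1 := h.ofReal_abs_psip_sub_le hψ hp hx hy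
  have h2 : |y - x| < δ := by linarith
  have h3 := hball (y := |y - x|) (by simpa using h2)
  exact (ENNReal.ofReal_lt_ofReal_iff hη).1 (h1.trans_lt h3)

theorem PsiHypP.exists_modulus_of_bounded {ψ : ℝ → ℝ} {p : ℝ} (hψ : PsiHypP ψ p) (hp : 1 < p)
    (a b K R : ℝ) {η : ℝ} (hη : 0 < η) :
    ∃ δ > 0, ∀ U V W : ℝ → ℝ, EnergyBound ψ p a b K U V W → (∀ x ∈ Icc a b, |V x| ≤ R) →
      ∀ x ∈ Icc a b, ∀ y ∈ Icc a b, |y - x| ≤ δ → |V y - V x| < η := by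
  obtain ⟨κ, hκ, hlow⟩ := hψ.exists_mul_abs_sub_le (by linarith) R
  obtain ⟨δ, hδ, hmod⟩ := hψ.exists_modulus hp a b K (mul_pos hκ hη)
  refine ⟨δ, hδ, fun U V W h hR x hx y hy hxy => ?_⟩
  have h1 := hmod U V W h x hx y hy hxy
  have h2 := hlow _ (abs_le.1 (hR x hx)) _ (abs_le.1 (hR y hy))
  exact lt_of_mul_lt_mul_left (h2.trans_lt h1) hκ.le

/-- If `f` grows with slope at least `ε` near a point of `[a,b]`, its `L¹` norm is bounded below. -/
theorem le_integral_abs_of_slope_ge {a b x₀ δ ε : ℝ} {f : ℝ → ℝ} (hδ : 0 < δ)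
    (hδab : 2 * δ ≤ b - a) (hx₀ : x₀ ∈ Icc a b) (hf : IntegrableOn f (Ioo a b))
    (h : ∀ x ∈ Icc a b, ∀ y ∈ Icc a b, |x - x₀| ≤ δ → |y - x₀| ≤ δ → x ≤ y →
      ε * (y - x) ≤ f y - f x) :
    ε * δ ^ 2 / 4 ≤ ∫ x in Ioo a b, |f x| := by
  obtain ⟨c, hac, hcb, hcx, hxc⟩ : ∃ c, a ≤ c ∧ c + δ ≤ b ∧ x₀ - δ ≤ c ∧ c ≤ x₀ := by
    rcases le_total (x₀ + δ) b with hb | hb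
    · exact ⟨x₀, hx₀.1, hb, by linarith, le_rfl⟩
    · exact ⟨x₀ - δ, by linarith, by linarith [hx₀.2], le_rfl, by linarith⟩
  have hfabs : IntegrableOn (fun x => |f x|) (Icc a b) := by
    rw [integrableOn_Icc_iff_integrableOn_Ioo]; exact hf.abs
  have hii : ∀ u ∈ Icc a b, ∀ v ∈ Icc a b, IntervalIntegrable (fun x => |f x|) volume u v :=
    fun u hu v hv => (hfabs.mono_set (uIcc_subset_Icc hu hv)).intervalIntegrable
  have hc0 : c ∈ Icc a b := ⟨hac, by linarith⟩
  have hc1 : c + δ / 2 ∈ Icc a b := ⟨by linarith, by linarith⟩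
  have hc2 : c + δ ∈ Icc a b := ⟨by linarith, hcb⟩
  have hshift : ∫ t in c..c + δ / 2, |f (t + δ / 2)| = ∫ t in c + δ / 2..c + δ, |f t| := by
    rw [intervalIntegral.integral_comp_add_right (fun t => |f t|)]
    congr 1; ring
  have hi2 : IntervalIntegrable (fun t => |f (t + δ / 2)|) volume c (c + δ / 2) := by
    have := (hii _ hc1 _ hc2).comp_add_right (δ / 2)
    convert this using 1 <;> ring
  have hlow : ∫ _ in c..c + δ / 2, ε * (δ / 2) ≤
      ∫ t in c..c + δ / 2, (|f t| + |f (t + δ / 2)|) := by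
    refine intervalIntegral.integral_mono_on (by linarith) (by simp)
      ((hii _ hc0 _ hc1).add hi2) ?_
    intro t ht
    have h1 := h t ⟨by linarith [ht.1], by linarith [ht.2]⟩ (t + δ / 2)
      ⟨by linarith [ht.1], by linarith [ht.2]⟩
      (abs_le.2 ⟨by linarith [ht.1], by linarith [ht.2]⟩)
      (abs_le.2 ⟨by linarith [ht.1], by linarith [ht.2]⟩) (by linarith)
    have h2 := neg_abs_le (f t)
    have h3 := le_abs_self (f (t + δ / 2))
    have h4 : t + δ / 2 - t = δ / 2 := by ring
    rw [h4] at h1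
    linarith
  rw [intervalIntegral.integral_add (hii _ hc0 _ hc1) hi2, hshift,
    intervalIntegral.integral_add_adjacent_intervals (hii _ hc0 _ hc1) (hii _ hc1 _ hc2),
    intervalIntegral.integral_const, intervalIntegral.integral_of_le (by linarith),
    smul_eq_mul] at hlow
  have hup : ∫ t in Ioc c (c + δ), |f t| ≤ ∫ t in Icc a b, |f t| :=
    setIntegral_mono_set hfabs (Eventually.of_forall fun _ => abs_nonneg _)
      (Ioc_subset_Icc_self.trans (Icc_subset_Icc hac hcb)).eventuallyLE
  rw [integral_Icc_eq_integral_Ioo] at hup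
  calc ε * δ ^ 2 / 4 = (c + δ / 2 - c) * (ε * (δ / 2)) := by ring
    _ ≤ _ := hlow.trans hup

theorem W2pRep.exists_energyBound {ψ : ℝ → ℝ} {p a b K : ℝ} {f v w : ℝ → ℝ}
    (h : W2pRep p a b f v w) (hψ : PsiHypP ψ p) (hab : a < b) (hp : 0 < p)
    (hK : (∫ x in Ioo a b, |v x|) + ∫ x in Ioo a b, ψ (v x) * |w x| ^ p ≤ K) :
    ∃ U V W : ℝ → ℝ, EnergyBound ψ p a b K U V W ∧ ∀ x ∈ Ioo a b, f x = U x := by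
  obtain ⟨hfd, hvw, -, hv, hw, hwp⟩ := h
  obtain ⟨m, hm⟩ : (Ioo a b).Nonempty := nonempty_Ioo.2 hab
  set W : ℝ → ℝ := (Ioo a b).indicator w with hWdef
  have hWi : Integrable W := hw.integrable_indicator measurableSet_Ioo
  have hWii : ∀ x y, IntervalIntegrable W volume x y := fun x y => hWi.intervalIntegrable
  set V : ℝ → ℝ := fun t => v m + ∫ s in m..t, W s with hVdef
  have hVc : Continuous V :=
    continuous_const.add (intervalIntegral.continuous_primitive hWii m)
  have hVv : ∀ x ∈ Ioo a b, V x = v x := by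
    intro x hx
    have h1 : ∫ s in m..x, W s = ∫ s in m..x, w s := by
      refine intervalIntegral.integral_congr fun s hs => ?_
      exact indicator_of_mem (ordConnected_Ioo.uIcc_subset hm hx hs) w
    simp only [hVdef]
    rw [h1, ← hvw m hm x hx]
    ring
  set U : ℝ → ℝ := fun t => f m + ∫ s in m..t, V s with hUdef
  have hfU : ∀ x ∈ Ioo a b, f x = U x := by
    intro x hx
    have h1 : ∫ s in m..x, V s = f x - f m := by
      refine intervalIntegral.integral_eq_sub_of_hasDerivAt (fun t ht => ?_)
        (hVc.intervalIntegrable _ _)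
      have ht' := ordConnected_Ioo.uIcc_subset hm hx ht
      rw [hVv t ht']
      exact hfd t ht'
    simp only [hUdef]
    rw [h1]
    ring
  have hψi : IntegrableOn (fun x => ψ (v x) * |w x| ^ p) (Ioo a b) := by
    obtain ⟨B, hB⟩ := hψ.bounded
    refine hwp.bdd_mul (c := B) ?_ (Eventually.of_forall fun x => ?_)
    · exact (hψ.measurable.comp_aemeasurable hv.aemeasurable).aestronglyMeasurable
    · rw [Real.norm_eq_abs, abs_of_pos (hψ.pos _)]
      exact hB _
  have hnn : ∀ x, 0 ≤ ψ (v x) * |w x| ^ p := fun x =>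
    mul_nonneg (hψ.pos _).le (Real.rpow_nonneg (abs_nonneg _) _)
  refine ⟨U, V, W, ⟨hWi, fun x y => ?_, fun x => ?_, ?_, ?_⟩, hfU⟩
  · simp only [hVdef]
    rw [← intervalIntegral.integral_interval_sub_left (hWii m y) (hWii m x)]
    ring
  · exact (intervalIntegral.integral_hasDerivAt_right (hVc.intervalIntegrable _ _)
      (hVc.stronglyMeasurableAtFilter _ _) hVc.continuousAt).const_add _
  · rw [← setLIntegral_congr Ioo_ae_eq_Icc]
    have h1 : ∫⁻ t in Ioo a b, ‖W t‖ₑ ^ p * ENNReal.ofReal (ψ (V t)) =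
        ∫⁻ t in Ioo a b, ENNReal.ofReal (ψ (v t) * |w t| ^ p) := by
      refine setLIntegral_congr_fun measurableSet_Ioo fun t ht => ?_
      rw [hVv t ht, hWdef, indicator_of_mem ht, ENNReal.ofReal_mul (hψ.pos _).le, mul_comm,
        ← ENNReal.ofReal_rpow_of_nonneg (abs_nonneg _) hp.le, ← Real.norm_eq_abs, ofReal_norm]
    rw [h1, ← ofReal_integral_eq_lintegral_ofReal hψi (Eventually.of_forall hnn)]
    refine ENNReal.ofReal_le_ofReal ?_
    have : 0 ≤ ∫ x in Ioo a b, |v x| := integral_nonneg fun _ => abs_nonneg _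
    linarith
  · have h1 : ∫ t in Ioo a b, |V t| = ∫ t in Ioo a b, |v t| :=
      setIntegral_congr_fun measurableSet_Ioo fun t ht => by simp only [hVv t ht]
    have : 0 ≤ ∫ x in Ioo a b, ψ (v x) * |w x| ^ p := integral_nonneg hnn
    linarith

/-- A function of finite relaxed energy is the `L¹` limit of functions with bounded energy. -/
theorem exists_seq_energyBound {ψ : ℝ → ℝ} {p a b K : ℝ} {u : ℝ → ℝ} (hψ : PsiHypP ψ p)
    (hab : a < b) (hp : 0 < p) (hu : FpRel ψ p a b u < ENNReal.ofReal K) :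
    ∃ U V W : ℕ → ℝ → ℝ, (∀ k, EnergyBound ψ p a b K (U k) (V k) (W k)) ∧
      TendstoL1 a b U u := by
  simp only [FpRel, iInf_lt_iff] at hu
  obtain ⟨F, ⟨hFi, hui, hF⟩, hlim⟩ := hu
  obtain ⟨ns, hns, hlt⟩ := extraction_of_frequently_atTop (frequently_lt_of_liminf_lt (by isBoundedDefault) hlim)
  have hex : ∀ k, ∃ U V W : ℝ → ℝ, EnergyBound ψ p a b K U V W ∧
      ∀ x ∈ Ioo a b, F (ns k) x = U x := by
    intro k
    have h := hlt k
    simp only [Fp, iInf_lt_iff] at h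
    obtain ⟨v, w, hrep, h⟩ := h
    exact hrep.exists_energyBound hψ hab hp (ENNReal.lt_ofReal_iff_toReal_lt ENNReal.ofReal_ne_top
      |>.1 h |>.le |> (ENNReal.toReal_ofReal (add_nonneg (integral_nonneg fun _ => abs_nonneg _)
        (integral_nonneg fun x => mul_nonneg (hψ.pos _).le
          (Real.rpow_nonneg (abs_nonneg _) _)))).symm.trans_le)
  choose U V W hE hFU using hex
  refine ⟨U, V, W, hE, fun k => ?_, hui, ?_⟩
  · exact (hFi (ns k)).congr_fun (hFU k) measurableSet_Ioo
  · refine (hF.comp hns.tendsto_atTop).congr fun k => ?_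
    exact setIntegral_congr_fun measurableSet_Ioo fun x hx => by simp only [hFU k x hx]

theorem TendstoL1.exists_subseq_ae_tendsto {a b : ℝ} {U : ℕ → ℝ → ℝ} {u : ℝ → ℝ}
    (h : TendstoL1 a b U u) :
    ∃ ns : ℕ → ℕ, StrictMono ns ∧ ∀ᵐ x ∂(volume.restrict (Ioo a b)),
      Tendsto (fun k => U (ns k) x) atTop (𝓝 (u x)) := by
  obtain ⟨hU, hu, hlim⟩ := h
  have hm : TendstoInMeasure (volume.restrict (Ioo a b)) U atTop u := by
    refine tendstoInMeasure_of_tendsto_eLpNorm one_ne_zero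
      (fun n => (hU n).aestronglyMeasurable) hu.aestronglyMeasurable ?_
    have h1 := (ENNReal.continuous_ofReal.tendsto 0).comp hlim
    rw [ENNReal.ofReal_zero] at h1
    refine h1.congr fun k => ?_
    rw [eLpNorm_one_eq_lintegral_enorm]
    exact ofReal_integral_norm_eq_lintegral_enorm ((hU k).sub hu)
  exact hm.exists_seq_tendsto_ae

theorem EnergyBound.abs_sub_le {ψ : ℝ → ℝ} {p a b K : ℝ} {U V W : ℝ → ℝ}
    (h : EnergyBound ψ p a b K U V W) {x y : ℝ} (hx : x ∈ Icc a b) (hy : y ∈ Icc a b) :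
    |U y - U x| ≤ K := by
  rw [h.sub_eq_integral, ← Real.norm_eq_abs]
  refine intervalIntegral.norm_integral_le_integral_norm_uIoc.trans (le_trans ?_ h.integral_le)
  rw [← integral_Icc_eq_integral_Ioo]
  exact setIntegral_mono_set (h.continuous.abs.continuousOn.integrableOn_compact isCompact_Icc)
    (Eventually.of_forall fun _ => abs_nonneg _)
    (uIoc_subset_uIcc.trans (uIcc_subset_Icc hx hy)).eventuallyLE

theorem exists_mem_Ioo_of_ae {a b : ℝ} (hab : a < b) {P : ℝ → Prop}
    (h : ∀ᵐ x ∂(volume.restrict (Ioo a b)), P x) : ∃ x ∈ Ioo a b, P x := by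
  have : NeBot (ae (volume.restrict (Ioo a b))) := by
    rw [ae_restrict_neBot]
    simpa using hab
  exact ((ae_restrict_mem measurableSet_Ioo).and h).exists

theorem exists_ae_abs_le {ψ : ℝ → ℝ} {p a b K : ℝ} (hab : a < b) {U V W : ℕ → ℝ → ℝ}
    {u : ℝ → ℝ} (hE : ∀ k, EnergyBound ψ p a b K (U k) (V k) (W k)) (hL : TendstoL1 a b U u) :
    ∃ B, ∀ᵐ x ∂(volume.restrict (Ioo a b)), |u x| ≤ B := by
  obtain ⟨ns, -, hae⟩ := hL.exists_subseq_ae_tendsto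
  obtain ⟨m, hm, hmlim⟩ := exists_mem_Ioo_of_ae hab hae
  refine ⟨|u m| + K, ?_⟩
  filter_upwards [hae, ae_restrict_mem measurableSet_Ioo] with x hx hxm
  have h1 : |u x - u m| ≤ K := le_of_tendsto' ((hx.sub hmlim).abs) fun k =>
    (hE (ns k)).abs_sub_le (Ioo_subset_Icc_self hm) (Ioo_subset_Icc_self hxm)
  have h2 := abs_sub_abs_le_abs_sub (u x) (u m)
  linarith

theorem mul_sub_le_sub_of_hasDerivAt {f f' : ℝ → ℝ} (hf : ∀ x, HasDerivAt f (f' x) x) {c x y : ℝ}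
    (hxy : x ≤ y) (hc : ∀ t ∈ Icc x y, c ≤ f' t) : c * (y - x) ≤ f y - f x :=
  (convex_Icc x y).mul_sub_le_image_sub_of_le_deriv
    (fun t _ => (hf t).continuousAt.continuousWithinAt)
    (fun t _ => (hf t).differentiableAt.differentiableWithinAt)
    (fun t ht => by rw [(hf t).deriv]; exact hc t (interior_subset ht))
    x (left_mem_Icc.2 hxy) y (right_mem_Icc.2 hxy) hxy

theorem integral_abs_sub_le {α : Type*} [MeasurableSpace α] {μ : Measure α} {f g h : α → ℝ}
    (hf : Integrable f μ) (hg : Integrable g μ) (hh : Integrable h μ) :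
    ∫ x, |f x - h x| ∂μ ≤ (∫ x, |f x - g x| ∂μ) + ∫ x, |g x - h x| ∂μ := by
  have h1 : Integrable (fun x => |f x - g x|) μ := (hf.sub hg).abs
  have h2 : Integrable (fun x => |g x - h x|) μ := (hg.sub hh).abs
  rw [← integral_add h1 h2]
  exact integral_mono (hf.sub hh).abs (h1.add h2) fun x => abs_sub_le _ _ _

/-- If the first derivatives of an `L¹`-convergent sequence of bounded energy are uniformly
bounded, they converge uniformly. -/
theorem uniformCauchySeqOn_of_energyBound {ψ : ℝ → ℝ} {p a b K R : ℝ} (hψ : PsiHypP ψ p)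
    (hp : 1 < p) (hab : a < b) {U V W : ℕ → ℝ → ℝ} {u : ℝ → ℝ}
    (hE : ∀ k, EnergyBound ψ p a b K (U k) (V k) (W k)) (hL : TendstoL1 a b U u)
    (hR : ∀ k, ∀ x ∈ Icc a b, |V k x| ≤ R) :
    UniformCauchySeqOn V atTop (Icc a b) := by
  rw [Metric.uniformCauchySeqOn_iff]
  intro ε hε
  obtain ⟨δ₀, hδ₀, hmod⟩ := hψ.exists_modulus_of_bounded hp a b K R (η := ε / 3) (by positivity)
  set δ := min δ₀ ((b - a) / 2) with hδdef
  have hδ : 0 < δ := lt_min hδ₀ (by linarith)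
  have hδ1 : δ ≤ δ₀ := min_le_left _ _
  have hδ2 : δ ≤ (b - a) / 2 := min_le_right _ _
  obtain ⟨N, hN⟩ := eventually_atTop.1
    (hL.2.2.eventually (gt_mem_nhds (show 0 < ε / 3 * δ ^ 2 / 4 / 2 by positivity)))
  have key : ∀ k ≥ N, ∀ l ≥ N, ∀ x ∈ Icc a b, V k x - V l x < ε := by
    intro k hk l hl x₀ hx₀
    by_contra! hcon
    have h1 : ε / 3 * δ ^ 2 / 4 ≤ ∫ x in Ioo a b, |U k x - U l x| := by
      refine le_integral_abs_of_slope_ge hδ (by linarith) hx₀ ((hL.1 k).sub (hL.1 l)) ?_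
      intro x hx y hy hxx hyx hxy
      refine mul_sub_le_sub_of_hasDerivAt
        (fun t => ((hE k).hasDerivAt t).sub ((hE l).hasDerivAt t)) hxy fun t ht => ?_
      have htI : t ∈ Icc a b := ⟨hx.1.trans ht.1, ht.2.trans hy.2⟩
      have htx : |t - x₀| ≤ δ₀ := by
        rw [abs_le] at *
        constructor <;> linarith [ht.1, ht.2]
      have h2 := abs_lt.1 (hmod _ _ _ (hE k) (hR k) x₀ hx₀ t htI htx)
      have h3 := abs_lt.1 (hmod _ _ _ (hE l) (hR l) x₀ hx₀ t htI htx)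
      linarith [h2.1, h3.2]
    have h2 := integral_abs_sub_le (hL.1 k) hL.2.1 (hL.1 l)
    simp only [abs_sub_comm (u _)] at h2
    linarith [hN k hk, hN l hl]
  refine ⟨N, fun k hk l hl x hx => ?_⟩
  rw [Real.dist_eq, abs_lt]
  exact ⟨by linarith [key l hl k hk x hx], key k hk l hl x hx⟩

theorem exists_c1Rep_of_energyBound {ψ : ℝ → ℝ} {p a b K R : ℝ} (hψ : PsiHypP ψ p)
    (hp : 1 < p) (hab : a < b) {U V W : ℕ → ℝ → ℝ} {u : ℝ → ℝ}
    (hE : ∀ k, EnergyBound ψ p a b K (U k) (V k) (W k)) (hL : TendstoL1 a b U u)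
    (hR : ∀ k, ∀ x ∈ Icc a b, |V k x| ≤ R) :
    ∃ ubar, C1Rep a b u ubar := by
  have hcau := uniformCauchySeqOn_of_energyBound hψ hp hab hE hL hR
  have hlim : ∀ x ∈ Icc a b, ∃ l, Tendsto (fun k => V k x) atTop (𝓝 l) := fun x hx =>
    cauchySeq_tendsto_of_complete (hcau.cauchySeq hx)
  choose! v hv using hlim
  have hunif := hcau.tendstoUniformlyOn_of_tendsto hv
  have hvc : ContinuousOn v (Icc a b) :=
    hunif.continuousOn (Eventually.of_forall fun k => (hE k).continuous.continuousOn).frequently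
  set v' : ℝ → ℝ := IccExtend hab.le ((Icc a b).domRestrict v) with hv'
  have hv'c : Continuous v' := hvc.domRestrict.Icc_extend'
  have hvv' : ∀ x ∈ Icc a b, v' x = v x := fun x hx => IccExtend_of_mem hab.le _ hx
  obtain ⟨ns, hns, hae⟩ := hL.exists_subseq_ae_tendsto
  obtain ⟨m, hm, hmlim⟩ := exists_mem_Ioo_of_ae hab hae
  refine ⟨fun x => u m + ∫ t in m..x, v' t, ?_, ?_⟩
  · filter_upwards [hae, ae_restrict_mem measurableSet_Ioo] with x hx hxm
    have hsub : uIcc m x ⊆ Icc a b :=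
      uIcc_subset_Icc (Ioo_subset_Icc_self hm) (Ioo_subset_Icc_self hxm)
    have h1 : Tendsto (fun k => ∫ t in m..x, V (ns k) t) atTop (𝓝 (∫ t in m..x, v' t)) := by
      refine intervalIntegral.tendsto_integral_filter_of_dominated_convergence (fun _ => R)
        (Eventually.of_forall fun k => (hE _).continuous.aestronglyMeasurable)
        (Eventually.of_forall fun k => Eventually.of_forall fun t ht =>
          hR _ t (hsub (uIoc_subset_uIcc ht)))
        (by simp) (Eventually.of_forall fun t ht => ?_)
      rw [hvv' t (hsub (uIoc_subset_uIcc ht))]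
      exact (hv t (hsub (uIoc_subset_uIcc ht))).comp hns.tendsto_atTop
    refine tendsto_nhds_unique (hmlim.add h1) (hx.congr fun k => ?_)
    rw [← (hE (ns k)).sub_eq_integral]
    ring
  · have hd : ∀ x, HasDerivAt (fun x => u m + ∫ t in m..x, v' t) (v' x) x := fun x =>
      (intervalIntegral.integral_hasDerivAt_right (hv'c.intervalIntegrable _ _)
        (hv'c.stronglyMeasurableAtFilter _ _) hv'c.continuousAt).const_add _
    refine (contDiff_one_iff_deriv.2 ⟨fun x => (hd x).differentiableAt, ?_⟩).contDiffOn
    rwa [funext fun x => (hd x).deriv]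

/-- Functions of bounded energy which are `L¹`-close to a `C`-Lipschitz function have derivative
bounded by `C + 2`. -/
theorem PsiHypP.exists_abs_deriv_le {ψ : ℝ → ℝ} {p : ℝ} (hψ : PsiHypP ψ p) (hp : 1 < p)
    {a b : ℝ} (hab : a < b) (K : ℝ) {C : ℝ} (hC : 0 ≤ C) :
    ∃ τ > 0, ∀ g : ℝ → ℝ, IntegrableOn g (Ioo a b) →
      (∀ x ∈ Icc a b, ∀ y ∈ Icc a b, |g y - g x| ≤ C * |y - x|) →
      ∀ U V W : ℝ → ℝ, EnergyBound ψ p a b K U V W →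
        ∫ x in Ioo a b, |U x - g x| < τ → ∀ x ∈ Icc a b, |V x| ≤ C + 2 := by
  obtain ⟨κ, hκ, hlow⟩ := hψ.exists_mul_abs_sub_le (by linarith) (C + 2)
  obtain ⟨δ₀, hδ₀, hmod⟩ := hψ.exists_modulus hp a b K hκ
  set δ := min δ₀ ((b - a) / 2) with hδdef
  have hδ : 0 < δ := lt_min hδ₀ (by linarith)
  have hδ1 : δ ≤ δ₀ := min_le_left _ _
  have hδ2 : δ ≤ (b - a) / 2 := min_le_right _ _
  refine ⟨1 * δ ^ 2 / 4, by positivity, ?_⟩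
  intro g hg hgL U V W hE hlt x₀ hx₀
  have hU : IntegrableOn U (Ioo a b) :=
    (((continuous_iff_continuousAt.2 fun x => (hE.hasDerivAt x).continuousAt).continuousOn
      (s := Icc a b)).integrableOn_compact isCompact_Icc).mono_set Ioo_subset_Icc_self
  have hgap : ∀ s t, C + 2 ≤ t → s ≤ C + 1 → κ ≤ Psip ψ p t - Psip ψ p s := by
    intro s t ht hs
    have h1 := hlow (C + 1) ⟨by linarith, by linarith⟩ (C + 2) ⟨by linarith, le_rfl⟩
    have h2 := hψ.psip_mono ht
    have h3 := hψ.psip_mono hs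
    have h4 := hψ.psip_mono (show C + 1 ≤ C + 2 by linarith)
    rw [abs_of_nonneg (by linarith), abs_of_nonneg (by linarith)] at h1
    linarith
  have hgap' : ∀ s t, t ≤ -(C + 2) → -(C + 1) ≤ s → κ ≤ Psip ψ p s - Psip ψ p t := by
    intro s t ht hs
    have h1 := hlow (-(C + 2)) ⟨le_rfl, by linarith⟩ (-(C + 1)) ⟨by linarith, by linarith⟩
    have h2 := hψ.psip_mono ht
    have h3 := hψ.psip_mono hs
    have h4 := hψ.psip_mono (show -(C + 2) ≤ -(C + 1) by linarith)
    rw [abs_of_nonneg (by linarith), abs_of_nonneg (by linarith)] at h1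
    linarith
  have hnear : ∀ x ∈ Icc a b, ∀ y ∈ Icc a b, |x - x₀| ≤ δ → |y - x₀| ≤ δ → ∀ t ∈ Icc x y,
      |Psip ψ p (V t) - Psip ψ p (V x₀)| < κ := by
    intro x hx y hy hxx hyx t ht
    refine hmod U V W hE x₀ hx₀ t ⟨hx.1.trans ht.1, ht.2.trans hy.2⟩ ?_
    rw [abs_le] at *
    constructor <;> linarith [ht.1, ht.2]
  by_contra! hcon
  rcases lt_abs.1 hcon with hpos | hneg
  · refine hlt.not_ge (le_integral_abs_of_slope_ge hδ (by linarith) hx₀ (hU.sub hg) ?_)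
    intro x hx y hy hxx hyx hxy
    have h1 : (C + 1) * (y - x) ≤ U y - U x := by
      refine mul_sub_le_sub_of_hasDerivAt hE.hasDerivAt hxy fun t ht => ?_
      by_contra! hlt'
      have := (abs_lt.1 (hnear x hx y hy hxx hyx t ht)).1
      linarith [hgap (V t) (V x₀) hpos.le hlt'.le]
    have h2 := (le_abs_self _).trans (hgL x hx y hy)
    rw [abs_of_nonneg (sub_nonneg.2 hxy)] at h2
    linarith
  · have hlt2 : ∫ x in Ioo a b, |g x - U x| < 1 * δ ^ 2 / 4 := by
      simpa only [abs_sub_comm (g _)] using hlt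
    refine hlt2.not_ge (le_integral_abs_of_slope_ge hδ (by linarith) hx₀ (hg.sub hU) ?_)
    intro x hx y hy hxx hyx hxy
    have h1 : (C + 1) * (y - x) ≤ (-U) y - (-U) x := by
      refine mul_sub_le_sub_of_hasDerivAt (fun s => (hE.hasDerivAt s).neg) hxy fun t ht => ?_
      by_contra! hlt'
      have := (abs_lt.1 (hnear x hx y hy hxx hyx t ht)).2
      linarith [hgap' (V t) (V x₀) (by linarith) (by linarith)]
    have h2 := (neg_abs_le _).trans' (neg_le_neg (hgL x hx y hy))
    rw [abs_of_nonneg (sub_nonneg.2 hxy)] at h2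
    simp only [Pi.neg_apply] at h1
    linarith

/-- A quantitative comparison between the `L¹` and `L²` norms. -/
theorem integral_abs_le_of_integral_sq_le {a b θ M : ℝ} {f : ℝ → ℝ} (hab : a ≤ b) (hθ : 0 < θ)
    (hf : IntegrableOn f (Ioo a b)) (hf2 : IntegrableOn (fun x => f x ^ 2) (Ioo a b))
    (hM : ∫ x in Ioo a b, f x ^ 2 ≤ M) :
    ∫ x in Ioo a b, |f x| ≤ θ * (b - a) + M / θ := by
  have hc : IntegrableOn (fun _ : ℝ => θ) (Ioo a b) := integrableOn_const (by simp)
  have h1 : ∫ x in Ioo a b, |f x| ≤ ∫ x in Ioo a b, (θ + f x ^ 2 / θ) := by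
    refine integral_mono hf.abs (hc.add (hf2.div_const θ)) fun x => ?_
    rw [← sub_nonneg]
    have h : θ + f x ^ 2 / θ - |f x| = ((θ - |f x|) ^ 2 + θ * |f x|) / θ := by
      field_simp
      rw [← sq_abs (f x)]
      ring
    dsimp only
    rw [h]
    positivity
  rw [integral_add hc (hf2.div_const θ), integral_div, setIntegral_const] at h1
  simp only [measureReal_def, Real.volume_Ioo, ENNReal.toReal_ofReal (sub_nonneg.2 hab),
    smul_eq_mul] at h1
  have h2 : (∫ x in Ioo a b, f x ^ 2) / θ ≤ M / θ := by gcongr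
  linarith

/-- `C¹` regularity, `p > 1`: for every `C > 0` there is `λ̄ = λ̄(C)`
such that for every datum `g ∈ C¹([a,b]) ∩ X^p_ψ(]a,b[)` with `‖g‖_{C¹} ≤ C` and
`F̄_p(g) ≤ C`, and every `λ ≥ λ̄`, every solution of the minimization problem is
`C¹([a,b])`. -/
theorem statement_17 (a b p : ℝ) (hab : a < b) (hp : 1 < p)
    (ψ : ℝ → ℝ) (hψ : PsiHypP ψ p) :
    ∀ C : ℝ, 0 < C → ∃ lamBar : ℝ, ∀ g : ℝ → ℝ,
      ContDiffOn ℝ 1 g (Set.Icc a b) →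
      (∀ x ∈ Set.Icc a b, |g x| ≤ C ∧ |derivWithin g (Set.Icc a b) x| ≤ C) →
      (∃ μp μn : Measure ℝ, MemXp ψ p a b g μp μn) →
      FpRel ψ p a b g ≤ ENNReal.ofReal C →
      ∀ lam : ℝ, lamBar ≤ lam →
        ∀ u : ℝ → ℝ, IsSolutionP ψ p a b lam g u →
          ∃ ubar : ℝ → ℝ, C1Rep a b u ubar := by
  intro C hC
  obtain ⟨τ, hτ, hbound⟩ := hψ.exists_abs_deriv_le hp hab (C + 1) hC.le
  have hba : 0 < b - a := sub_pos.2 hab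
  set θ : ℝ := τ / (4 * (b - a)) with hθdef
  have hθ : 0 < θ := by positivity
  refine ⟨4 * C / (θ * τ), fun g hg hgC hgX hgF lam hlam u hu => ?_⟩
  have hlam0 : 0 < lam := lt_of_lt_of_le (by positivity) hlam
  have hle := hu.2 g hgX
  simp only [sub_self, ne_eq, OfNat.ofNat_ne_zero, not_false_eq_true, zero_pow, integral_zero,
    mul_zero, ENNReal.ofReal_zero, add_zero] at hle
  have hleC := hle.trans hgF
  have huF : FpRel ψ p a b u < ENNReal.ofReal (C + 1) :=
    (le_self_add.trans hleC).trans_lt ((ENNReal.ofReal_lt_ofReal_iff (by linarith)).2 (by linarith))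
  have hL2 : lam * ∫ x in Ioo a b, (u x - g x) ^ 2 ≤ C :=
    (ENNReal.ofReal_le_ofReal_iff hC.le).1 (le_add_self.trans hleC)
  obtain ⟨U, V, W, hE, hL⟩ := exists_seq_energyBound hψ hab (by linarith) huF
  obtain ⟨B, hB⟩ := exists_ae_abs_le hab hE hL
  have hgi : IntegrableOn g (Ioo a b) :=
    (hg.continuousOn.integrableOn_compact isCompact_Icc).mono_set Ioo_subset_Icc_self
  have hui : IntegrableOn u (Ioo a b) := hL.2.1
  have hsq : IntegrableOn (fun x => (u x - g x) ^ 2) (Ioo a b) := by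
    simp only [sq]
    refine (hui.sub hgi).bdd_mul (c := B + C) (hui.sub hgi).aestronglyMeasurable ?_
    filter_upwards [hB, ae_restrict_mem measurableSet_Ioo] with x hx hxm
    exact (norm_sub_le _ _).trans (add_le_add hx (hgC x (Ioo_subset_Icc_self hxm)).1)
  have hgL : ∀ x ∈ Icc a b, ∀ y ∈ Icc a b, |g y - g x| ≤ C * |y - x| := fun x hx y hy =>
    (convex_Icc a b).norm_image_sub_le_of_norm_derivWithin_le
      (hg.differentiableOn one_ne_zero) (fun t ht => (hgC t ht).2) hx hy
  have hM : ∫ x in Ioo a b, (u x - g x) ^ 2 ≤ θ * τ / 4 := by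
    have h1 : C ≤ θ * τ / 4 * lam := by
      rw [div_le_iff₀ (by positivity)] at hlam
      linarith
    exact le_of_mul_le_mul_left (hL2.trans (h1.trans_eq (mul_comm _ _))) hlam0
  have hL1 : ∫ x in Ioo a b, |u x - g x| ≤ τ / 2 := by
    refine (integral_abs_le_of_integral_sq_le hab.le hθ (hui.sub hgi) hsq hM).trans_eq ?_
    have h1 : θ * (b - a) = τ / 4 := by rw [hθdef]; field_simp
    have h2 : θ * τ / 4 / θ = τ / 4 := by field_simp
    rw [h1, h2]
    ring
  obtain ⟨N, hN⟩ := eventually_atTop.1 (hL.2.2.eventually (gt_mem_nhds (half_pos hτ)))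
  have hR : ∀ k, ∀ x ∈ Icc a b, |V (k + N) x| ≤ C + 2 := by
    intro k
    refine hbound g hgi hgL _ _ _ (hE (k + N)) ?_
    have h1 := integral_abs_sub_le (hL.1 (k + N)) hui hgi
    linarith [hN (k + N) (by omega)]
  exact exists_c1Rep_of_energyBound hψ hp hab (fun k => hE (k + N))
    ⟨fun k => hL.1 (k + N), hui, hL.2.2.comp (tendsto_add_atTop_nat N)⟩ hR
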